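/- arXiv:1509.08208 — 2 statements merged into one kernel-verified Lean document; each statement's English description precedes it below -/
import Mathlib

section
/- Let k ≥ 1 and let G and H be finite simple graphs with δ(G) ≥ k, δ(H) ≥ k and γ_{×k,t}(G) ≤ 2k·ρ(G). Then γ_{×k,t}(G) · γ_{×k,t}(H) ≤ 2k · γ_{×k,t}(G □ H). -/
open SimpleGraph Set

/-- `S` is a `k`-tuple total dominating set (kTDS) of `G`: every vertex of `G`
has at least `k` neighbors in `S`. -/
def IsKTDS {V : Type*} (G : SimpleGraph V) (k : ℕ) (S : Set V) : Prop :=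
  ∀ v : V, k ≤ (S ∩ G.neighborSet v).ncard

/-- The `k`-tuple total domination number `γ_{×k,t}(G)`: the minimum cardinality
of a `k`-tuple total dominating set of `G`. -/
noncomputable def kTotalDomNum {V : Type*} [Fintype V] (G : SimpleGraph V) (k : ℕ) : ℕ :=
  sInf {n : ℕ | ∃ S : Set V, IsKTDS G k S ∧ S.ncard = n}

/-- A packing of `G`: a set of vertices whose closed neighborhoods are pairwise disjoint. -/
def IsPacking {V : Type*} (G : SimpleGraph V) (S : Set V) : Prop :=
  S.Pairwise fun u v => Disjoint (insert u (G.neighborSet u)) (insert v (G.neighborSet v))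

/-- The packing number `ρ(G)`: the maximum cardinality of a packing of `G`. -/
noncomputable def packingNum {V : Type*} [Fintype V] (G : SimpleGraph V) : ℕ :=
  sSup {n : ℕ | ∃ S : Set V, IsPacking G S ∧ S.ncard = n}

/-- An open packing of `G`: a set of vertices whose open neighborhoods are pairwise disjoint. -/
def IsOpenPacking {V : Type*} (G : SimpleGraph V) (S : Set V) : Prop :=
  S.Pairwise fun u v => Disjoint (G.neighborSet u) (G.neighborSet v)

/-- The open packing number `ρ^open(G)`: the maximum cardinality of an open packing of `G`. -/
noncomputable def openPackingNum {V : Type*} [Fintype V] (G : SimpleGraph V) : ℕ :=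
  sSup {n : ℕ | ∃ S : Set V, IsOpenPacking G S ∧ S.ncard = n}

theorem IsKTDS.kTotalDomNum_le {V : Type*} [Fintype V] {G : SimpleGraph V} {k : ℕ} {S : Set V}
    (hS : IsKTDS G k S) : kTotalDomNum G k ≤ S.ncard :=
  Nat.sInf_le ⟨S, hS, rfl⟩

theorem exists_isKTDS_ncard_eq_kTotalDomNum {V : Type*} [Fintype V] {G : SimpleGraph V} {k : ℕ}
    (h : ∃ S : Set V, IsKTDS G k S) : ∃ S : Set V, IsKTDS G k S ∧ S.ncard = kTotalDomNum G k := by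
  obtain ⟨S, hS⟩ := h
  exact Nat.sInf_mem (s := {n : ℕ | ∃ S : Set V, IsKTDS G k S ∧ S.ncard = n}) ⟨_, S, hS, rfl⟩

theorem exists_isPacking_ncard_eq_packingNum {V : Type*} [Fintype V] (G : SimpleGraph V) :
    ∃ S : Set V, IsPacking G S ∧ S.ncard = packingNum G := by
  refine Nat.sSup_mem (s := {n : ℕ | ∃ S : Set V, IsPacking G S ∧ S.ncard = n})
    ⟨0, ∅, Set.pairwise_empty _, Set.ncard_empty V⟩ ⟨Nat.card V, ?_⟩
  rintro n ⟨S, -, rfl⟩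
  exact Set.ncard_le_card S

/-- The neighbors of `(u, w)` in `S` split into those in the fiber over `u` and those in the
fiber over `w`. -/
theorem ncard_inter_neighborSet_boxProd_le {V W : Type*} [Finite V] [Finite W]
    (G : SimpleGraph V) (H : SimpleGraph W) (S : Set (V × W)) (u : V) (w : W) :
    (S ∩ (G □ H).neighborSet (u, w)).ncard ≤
      ({w' | (u, w') ∈ S} ∩ H.neighborSet w).ncard +
        {p ∈ S | G.Adj u p.1 ∧ p.2 = w}.ncard := by
  rw [← Set.ncard_image_of_injective ({w' | (u, w') ∈ S} ∩ H.neighborSet w)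
    (Prod.mk_right_injective u)]
  refine (Set.ncard_le_ncard ?_).trans (Set.ncard_union_le _ _)
  rintro ⟨v, w'⟩ ⟨hp, hadj⟩
  rcases boxProd_adj.1 hadj with ⟨h, rfl⟩ | ⟨h, rfl⟩
  · exact Or.inr ⟨hp, h, rfl⟩
  · exact Or.inl ⟨w', ⟨hp, h⟩, rfl⟩

/-- If the minimum degree is at least `k` and every vertex `w` has at least `k - b w` neighbors in
`A`, then adding at most `∑ w, b w` vertices turns `A` into a `k`-tuple total dominating set. -/
theorem kTotalDomNum_le_ncard_add_sum {W : Type*} [Fintype W] {H : SimpleGraph W} {k : ℕ}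
    (hδ : ∀ w : W, k ≤ (H.neighborSet w).ncard) (A : Set W) (b : W → ℕ)
    (hA : ∀ w : W, k ≤ (A ∩ H.neighborSet w).ncard + b w) :
    kTotalDomNum H k ≤ A.ncard + ∑ w, b w := by
  have hT : ∀ w, ∃ T ⊆ H.neighborSet w, T.ncard ≤ b w ∧
      k ≤ ((A ∩ H.neighborSet w) ∪ T).ncard := by
    intro w
    rcases le_total k (A ∩ H.neighborSet w).ncard with h | h
    · exact ⟨∅, Set.empty_subset _, by simp, by simpa using h⟩
    · obtain ⟨T, hAT, hTN, hcard⟩ :=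
        Set.exists_subsuperset_card_eq Set.inter_subset_right h (hδ w)
      refine ⟨T \ (A ∩ H.neighborSet w), Set.sdiff_subset.trans hTN, ?_, ?_⟩
      · rw [Set.ncard_sdiff hAT]
        have := hA w
        omega
      · rw [Set.union_sdiff_cancel hAT, hcard]
  choose T hTN hTb hTk using hT
  have hD : IsKTDS H k (A ∪ ⋃ w, T w) := fun w =>
    (hTk w).trans <| Set.ncard_le_ncard <| Set.union_subset
      (Set.inter_subset_inter_left _ Set.subset_union_left)
      (Set.subset_inter ((Set.subset_iUnion T w).trans Set.subset_union_right) (hTN w))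
  calc kTotalDomNum H k ≤ (A ∪ ⋃ w, T w).ncard := hD.kTotalDomNum_le
    _ ≤ A.ncard + (⋃ w, T w).ncard := Set.ncard_union_le _ _
    _ ≤ A.ncard + ∑ w, (T w).ncard := by
      gcongr
      exact Set.ncard_iUnion_le_of_fintype T
    _ ≤ A.ncard + ∑ w, b w := by
      gcongr with w
      exact hTb w

theorem ncard_fiber_add_sum_le {V W : Type*} [Finite V] [Fintype W]
    (G : SimpleGraph V) (S : Set (V × W)) (u : V) :
    {w | (u, w) ∈ S}.ncard + ∑ w, {p ∈ S | G.Adj u p.1 ∧ p.2 = w}.ncard ≤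
      {p ∈ S | p.1 ∈ insert u (G.neighborSet u)}.ncard := by
  rw [← Set.ncard_image_of_injective {w | (u, w) ∈ S} (Prod.mk_right_injective u),
    ← finsum_eq_sum_of_fintype, ← Set.ncard_iUnion_of_finite (fun _ => Set.toFinite _),
    ← Set.ncard_union_eq]
  · refine Set.ncard_le_ncard ?_
    rintro p (⟨w, hw, rfl⟩ | hp)
    · exact ⟨hw, Set.mem_insert _ _⟩
    · obtain ⟨w, hp, hadj, -⟩ := Set.mem_iUnion.1 hp
      exact ⟨hp, Set.mem_insert_of_mem _ hadj⟩
  · rw [Set.disjoint_left]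
    rintro _ ⟨w, -, rfl⟩ hp
    obtain ⟨_, -, hadj, -⟩ := Set.mem_iUnion.1 hp
    exact G.irrefl hadj
  · intro w w' hne
    exact Set.disjoint_left.2 fun p hp hp' => hne (hp.2.2.symm.trans hp'.2.2)

theorem IsKTDS.kTotalDomNum_le_ncard_closedNeighborhood {V W : Type*} [Finite V] [Fintype W]
    {G : SimpleGraph V} {H : SimpleGraph W} {k : ℕ} (hδ : ∀ w : W, k ≤ (H.neighborSet w).ncard)
    {S : Set (V × W)} (hS : IsKTDS (G □ H) k S) (u : V) :
    kTotalDomNum H k ≤ {p ∈ S | p.1 ∈ insert u (G.neighborSet u)}.ncard :=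
  (kTotalDomNum_le_ncard_add_sum hδ _ _ fun w =>
    (hS (u, w)).trans (ncard_inter_neighborSet_boxProd_le G H S u w)).trans
    (ncard_fiber_add_sum_le G S u)

theorem IsPacking.ncard_mul_kTotalDomNum_le {V W : Type*} [Finite V] [Fintype W]
    {G : SimpleGraph V} {H : SimpleGraph W} {k : ℕ} (hδ : ∀ w : W, k ≤ (H.neighborSet w).ncard)
    {P : Set V} (hP : IsPacking G P) {S : Set (V × W)} (hS : IsKTDS (G □ H) k S) :
    P.ncard * kTotalDomNum H k ≤ S.ncard := by
  classical
  have := Fintype.ofFinite V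
  have hdisj : Pairwise fun u v : P => Disjoint
      {p ∈ S | p.1 ∈ insert u.1 (G.neighborSet u)} {p ∈ S | p.1 ∈ insert v.1 (G.neighborSet v)} :=
    fun u v hne => Set.disjoint_left.2 fun p hpu hpv =>
      Set.disjoint_left.1 (hP u.2 v.2 (Subtype.coe_ne_coe.2 hne)) hpu.2 hpv.2
  calc P.ncard * kTotalDomNum H k
      = ∑ _u : P, kTotalDomNum H k := by simp [Set.ncard_eq_toFinset_card']
    _ ≤ ∑ u : P, {p ∈ S | p.1 ∈ insert u.1 (G.neighborSet u)}.ncard :=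
      Finset.sum_le_sum fun u _ => hS.kTotalDomNum_le_ncard_closedNeighborhood hδ u.1
    _ = (⋃ u : P, {p ∈ S | p.1 ∈ insert u.1 (G.neighborSet u)}).ncard := by
      rw [Set.ncard_iUnion_of_finite (fun _ => Set.toFinite _) hdisj, finsum_eq_sum_of_fintype]
    _ ≤ S.ncard := Set.ncard_le_ncard (Set.iUnion_subset fun _ => Set.sep_subset _ _)

theorem packingNum_mul_kTotalDomNum_le {V W : Type*} [Fintype V] [Fintype W]
    {G : SimpleGraph V} {H : SimpleGraph W} {k : ℕ}
    (hδ : ∀ w : W, k ≤ (H.neighborSet w).ncard) (h : ∃ S, IsKTDS (G □ H) k S) :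
    packingNum G * kTotalDomNum H k ≤ kTotalDomNum (G □ H) k := by
  obtain ⟨P, hP, hPcard⟩ := exists_isPacking_ncard_eq_packingNum G
  obtain ⟨S, hS, hScard⟩ := exists_isKTDS_ncard_eq_kTotalDomNum h
  rw [← hPcard, ← hScard]
  exact hP.ncard_mul_kTotalDomNum_le hδ hS

theorem isKTDS_univ_boxProd {V W : Type*} [Finite V] [Finite W]
    (G : SimpleGraph V) {H : SimpleGraph W} {k : ℕ} (hδ : ∀ w : W, k ≤ (H.neighborSet w).ncard) :
    IsKTDS (G □ H) k Set.univ := by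
  rintro ⟨u, w⟩
  rw [Set.univ_inter]
  refine (hδ w).trans ?_
  rw [← Set.ncard_image_of_injective _ (Prod.mk_right_injective u)]
  refine Set.ncard_le_ncard ?_
  rintro _ ⟨w', hadj, rfl⟩
  exact boxProd_adj.2 (Or.inr ⟨hadj, rfl⟩)

theorem vizing_like_ktuple_total {V W : Type*} [Fintype V] [Fintype W]
    (G : SimpleGraph V) (H : SimpleGraph W) (k : ℕ) (hk : 1 ≤ k)
    (hδG : ∀ v : V, k ≤ (G.neighborSet v).ncard)
    (hδH : ∀ w : W, k ≤ (H.neighborSet w).ncard)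
    (hγ : kTotalDomNum G k ≤ 2 * k * packingNum G) :
    kTotalDomNum G k * kTotalDomNum H k ≤ 2 * k * kTotalDomNum (G □ H) k := by
  calc kTotalDomNum G k * kTotalDomNum H k
      ≤ 2 * k * packingNum G * kTotalDomNum H k := Nat.mul_le_mul_right _ hγ
    _ = 2 * k * (packingNum G * kTotalDomNum H k) := Nat.mul_assoc _ _ _
    _ ≤ 2 * k * kTotalDomNum (G □ H) k :=
      Nat.mul_le_mul_left _ (packingNum_mul_kTotalDomNum_le hδH ⟨_, isKTDS_univ_boxProd G hδH⟩)
end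

section
/- Let n ≥ 1 and m ≥ 1 with (n,m) ∉ {(1,1),(1,2),(2,1),(2,2),(3,3),(3,4),(4,3)}, and identify the vertices of K_n □ K_m with pairs (i,j) for i ∈ {0,…,n−1}, j ∈ {0,…,m−1}. Suppose there exists a 2-tuple total dominating set D of K_n □ K_m with |D| = γ_{×2,t}(K_n □ K_m) such that every row index i appears in some element of D and every column index j appears in some element of D. Then γ_{×2,t}(K_n □ K_m) = ⌈3(n+m)/4⌉ + 1 if m ≡ 3n + 4 (mod 8), and γ_{×2,t}(K_n □ K_m) = ⌈3(n+m)/4⌉ otherwise. -/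
open SimpleGraph Set

open Finset in
/-- A double counting: the members of a finite relation, each weighted by the inverse of the
number of members in its row, count the nonempty rows. -/
lemma sum_inv_fiber_card {α β : Type*} [Fintype α] [DecidableEq α] (F : Finset β) (f : β → α)
    (hf : ∀ a, ∃ b ∈ F, f b = a) :
    ∑ b ∈ F, ((#{x ∈ F | f x = f b} : ℚ))⁻¹ = Fintype.card α := by
  rw [← Finset.sum_fiberwise F f]
  have key : ∀ a : α, ∑ b ∈ F with f b = a, ((#{x ∈ F | f x = f b} : ℚ))⁻¹ = 1 := by
    intro a
    have hcongr : ∑ b ∈ F with f b = a, ((#{x ∈ F | f x = f b} : ℚ))⁻¹ =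
        ∑ b ∈ F with f b = a, ((#{x ∈ F | f x = a} : ℚ))⁻¹ :=
      Finset.sum_congr rfl fun b hb => by rw [(Finset.mem_filter.1 hb).2]
    rw [hcongr, Finset.sum_const, nsmul_eq_mul, mul_inv_cancel₀]
    obtain ⟨b, hb, hba⟩ := hf a
    exact Nat.cast_ne_zero.2 (Finset.card_ne_zero_of_mem (Finset.mem_filter.2 ⟨hb, hba⟩))
  simp [key]

lemma inv_add_inv_le_four_thirds {r c : ℕ} (hr : 1 ≤ r) (hc : 1 ≤ c) (h : 4 ≤ r + c) :
    (r : ℚ)⁻¹ + (c : ℚ)⁻¹ ≤ 4 / 3 := by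
  have hr' : (1 : ℚ) ≤ r := by exact_mod_cast hr
  have hc' : (1 : ℚ) ≤ c := by exact_mod_cast hc
  have h' : (4 : ℚ) ≤ r + c := by exact_mod_cast h
  rw [inv_add_inv (by positivity) (by positivity), div_le_div_iff₀ (by positivity) (by norm_num)]
  nlinarith [mul_nonneg (sub_nonneg.2 hr') (sub_nonneg.2 hc')]

lemma eq_one_three_of_inv_add_inv_eq {r c : ℕ} (hr : 1 ≤ r) (hc : 1 ≤ c) (h : 4 ≤ r + c)
    (heq : (r : ℚ)⁻¹ + (c : ℚ)⁻¹ = 4 / 3) : (r = 1 ∧ c = 3) ∨ (r = 3 ∧ c = 1) := by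
  have hr0 : (r : ℚ) ≠ 0 := by positivity
  have hc0 : (c : ℚ) ≠ 0 := by positivity
  rw [inv_add_inv hr0 hc0, div_eq_div_iff (by positivity) (by norm_num)] at heq
  have heq' : (r + c) * 3 = 4 * (r * c) := by exact_mod_cast heq
  obtain ⟨x, rfl⟩ := Nat.exists_eq_add_of_le hr
  obtain ⟨y, rfl⟩ := Nat.exists_eq_add_of_le hc
  rcases Nat.eq_zero_or_pos x with rfl | hx
  · left; omega
  rcases Nat.eq_zero_or_pos y with rfl | hy
  · right; omega
  nlinarith

open Finset in
/-- In a rook's graph, an element of a 2-tuple total dominating set lies in a row and a column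
which together contain at least `4` elements of the set, that element being counted twice. -/
lemma four_le_row_add_col {n m : ℕ} {F : Finset (Fin n × Fin m)}
    (hF : IsKTDS ((⊤ : SimpleGraph (Fin n)) □ (⊤ : SimpleGraph (Fin m))) 2
      (F : Set (Fin n × Fin m))) {p : Fin n × Fin m} (hp : p ∈ F) :
    4 ≤ #{x ∈ F | x.1 = p.1} + #{x ∈ F | x.2 = p.2} := by
  have hsub : (F : Set (Fin n × Fin m)) ∩
      ((⊤ : SimpleGraph (Fin n)) □ (⊤ : SimpleGraph (Fin m))).neighborSet p ⊆
      (({x ∈ F | x.1 = p.1}.erase p ∪ {x ∈ F | x.2 = p.2}.erase p : Finset _) :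
        Set (Fin n × Fin m)) := by
    rintro x ⟨hxF, hx⟩
    have hx' := (SimpleGraph.mem_neighborSet _ _ _).1 hx
    have hne : x ≠ p := hx'.ne'
    rw [SimpleGraph.boxProd_adj] at hx'
    simp only [Finset.coe_union, Set.mem_union, Finset.mem_coe, Finset.mem_erase,
      Finset.mem_filter]
    rcases hx' with h | h
    · exact Or.inr ⟨hne, hxF, h.2.symm⟩
    · exact Or.inl ⟨hne, hxF, h.2.symm⟩
  have h1 := (hF p).trans (Set.ncard_le_ncard hsub (Finset.finite_toSet _))
  rw [Set.ncard_coe_finset] at h1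
  have h2 := h1.trans (Finset.card_union_le _ _)
  have hr : p ∈ ({x ∈ F | x.1 = p.1} : Finset _) := by simp [hp]
  have hc : p ∈ ({x ∈ F | x.2 = p.2} : Finset _) := by simp [hp]
  rw [Finset.card_erase_of_mem hr, Finset.card_erase_of_mem hc] at h2
  have := Finset.card_pos.2 ⟨p, hr⟩
  have := Finset.card_pos.2 ⟨p, hc⟩
  omega

open Finset in
lemma three_mul_le_four_mul_card {n m : ℕ} {F : Finset (Fin n × Fin m)}
    (hF : IsKTDS ((⊤ : SimpleGraph (Fin n)) □ (⊤ : SimpleGraph (Fin m))) 2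
      (F : Set (Fin n × Fin m)))
    (hrow : ∀ i, ∃ j, (i, j) ∈ F) (hcol : ∀ j, ∃ i, (i, j) ∈ F) :
    3 * (n + m) ≤ 4 * #F ∧ (3 * (n + m) = 4 * #F → m % 8 = 3 * n % 8) := by
  set r : Fin n × Fin m → ℕ := fun p => #{x ∈ F | x.1 = p.1} with hr
  set c : Fin n × Fin m → ℕ := fun p => #{x ∈ F | x.2 = p.2} with hc
  have hn : ∑ p ∈ F, (r p : ℚ)⁻¹ = n := by
    simpa using sum_inv_fiber_card F Prod.fst fun i => by
      obtain ⟨j, hj⟩ := hrow i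
      exact ⟨_, hj, rfl⟩
  have hm : ∑ p ∈ F, (c p : ℚ)⁻¹ = m := by
    simpa using sum_inv_fiber_card F Prod.snd fun j => by
      obtain ⟨i, hi⟩ := hcol j
      exact ⟨_, hi, rfl⟩
  have hr1 : ∀ p ∈ F, 1 ≤ r p := fun p hp => Finset.card_pos.2 ⟨p, by simp [hp]⟩
  have hc1 : ∀ p ∈ F, 1 ≤ c p := fun p hp => Finset.card_pos.2 ⟨p, by simp [hp]⟩
  have hle : ∀ p ∈ F, (r p : ℚ)⁻¹ + (c p : ℚ)⁻¹ ≤ 4 / 3 := fun p hp =>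
    inv_add_inv_le_four_thirds (hr1 p hp) (hc1 p hp) (four_le_row_add_col hF hp)
  have hsum : ∑ p ∈ F, ((r p : ℚ)⁻¹ + (c p : ℚ)⁻¹) = n + m := by
    rw [Finset.sum_add_distrib, hn, hm]
  have hconst : ∑ p ∈ F, (4 / 3 : ℚ) = #F * (4 / 3) := by simp
  refine ⟨?_, fun heq => ?_⟩
  · have h := Finset.sum_le_sum hle
    rw [hsum, hconst] at h
    have : (3 : ℚ) * (n + m) ≤ 4 * #F := by linarith
    exact_mod_cast this
  · have heq' : (3 : ℚ) * (n + m) = 4 * #F := by exact_mod_cast heq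
    have hall := (Finset.sum_eq_sum_iff_of_le hle).1 (by rw [hsum, hconst]; linarith)
    have hcase : ∀ p ∈ F, 9 * (r p : ℚ)⁻¹ - 3 * (c p : ℚ)⁻¹ = if r p = 1 then 8 else 0 := by
      intro p hp
      rcases eq_one_three_of_inv_add_inv_eq (hr1 p hp) (hc1 p hp) (four_le_row_add_col hF hp)
        (hall p hp) with ⟨h1, h2⟩ | ⟨h1, h2⟩ <;> rw [h1, h2] <;> norm_num
    have hk := Finset.sum_congr rfl hcase
    rw [Finset.sum_sub_distrib, ← Finset.mul_sum, ← Finset.mul_sum, hn, hm, ← Finset.sum_filter,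
      Finset.sum_const, nsmul_eq_mul] at hk
    have hk' : (9 * n : ℚ) = 3 * m + 8 * #{p ∈ F | r p = 1} := by linarith
    have hk'' : 9 * n = 3 * m + 8 * #{p ∈ F | r p = 1} := by exact_mod_cast hk'
    omega

/-- Every cell of an `n × m` board sees two cells of `S`, in its row or its column. -/
def RookDominates {n m : ℕ} (S : Set (Fin n × Fin m)) : Prop :=
  ∀ i j, ∃ u ∈ S, ∃ w ∈ S, u ≠ w ∧
    ((i ≠ u.1 ∧ j = u.2) ∨ (j ≠ u.2 ∧ i = u.1)) ∧ ((i ≠ w.1 ∧ j = w.2) ∨ (j ≠ w.2 ∧ i = w.1))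

lemma RookDominates.isKTDS {n m : ℕ} {S : Set (Fin n × Fin m)} (h : RookDominates S) :
    IsKTDS ((⊤ : SimpleGraph (Fin n)) □ (⊤ : SimpleGraph (Fin m))) 2 S := by
  rintro ⟨i, j⟩
  obtain ⟨u, hu, w, hw, hne, hau, haw⟩ := h i j
  refine (Set.one_lt_ncard (Set.toFinite _)).2 ⟨u, ⟨hu, ?_⟩, w, ⟨hw, ?_⟩, hne⟩
  · simpa [SimpleGraph.boxProd_adj] using hau
  · simpa [SimpleGraph.boxProd_adj] using haw

lemma RookDominates.swap {n m : ℕ} {S : Set (Fin n × Fin m)} (h : RookDominates S) :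
    RookDominates (Prod.swap '' S) := by
  intro j i
  obtain ⟨u, hu, w, hw, hne, hau, haw⟩ := h i j
  exact ⟨u.swap, ⟨u, hu, rfl⟩, w.swap, ⟨w, hw, rfl⟩, fun h => hne (Prod.swap_injective h),
    hau.symm, haw.symm⟩

/-- There is a dominating set of at most `e` cells of the `n × m` board. -/
def HasRookDominating (n m e : ℕ) : Prop :=
  ∃ S : Set (Fin n × Fin m), RookDominates S ∧ S.ncard ≤ e

/-- There is a dominating set of at most `e` cells meeting all rows and columns of the `n × m`
board. -/
def HasFullRookDominating (n m e : ℕ) : Prop :=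
  ∃ S : Set (Fin n × Fin m), RookDominates S ∧ (∀ i, ∃ j, (i, j) ∈ S) ∧
    (∀ j, ∃ i, (i, j) ∈ S) ∧ S.ncard ≤ e

lemma HasFullRookDominating.hasRookDominating {n m e : ℕ} (h : HasFullRookDominating n m e) :
    HasRookDominating n m e := by
  obtain ⟨S, hS, -, -, he⟩ := h
  exact ⟨S, hS, he⟩

lemma HasRookDominating.kTotalDomNum_le {n m e : ℕ} (h : HasRookDominating n m e) :
    kTotalDomNum ((⊤ : SimpleGraph (Fin n)) □ (⊤ : SimpleGraph (Fin m))) 2 ≤ e := by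
  obtain ⟨S, hS, he⟩ := h
  have hmem : S.ncard ∈ {k : ℕ | ∃ T : Set (Fin n × Fin m),
      IsKTDS ((⊤ : SimpleGraph (Fin n)) □ (⊤ : SimpleGraph (Fin m))) 2 T ∧ T.ncard = k} :=
    ⟨S, hS.isKTDS, rfl⟩
  exact (Nat.sInf_le hmem).trans he

lemma HasRookDominating.swap {n m e : ℕ} (h : HasRookDominating n m e) :
    HasRookDominating m n e := by
  obtain ⟨S, hS, he⟩ := h
  exact ⟨_, hS.swap, (Set.ncard_image_le (Set.toFinite _)).trans he⟩

lemma HasFullRookDominating.swap {n m e : ℕ} (h : HasFullRookDominating n m e) :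
    HasFullRookDominating m n e := by
  obtain ⟨S, hS, hr, hc, he⟩ := h
  refine ⟨_, hS.swap, fun j => ?_, fun i => ?_, (Set.ncard_image_le (Set.toFinite _)).trans he⟩
  · obtain ⟨i, hi⟩ := hc j
    exact ⟨i, _, hi, rfl⟩
  · obtain ⟨j, hj⟩ := hr i
    exact ⟨j, _, hj, rfl⟩

/-- Block diagonal sum of two boards. -/
lemma HasFullRookDominating.add {n m e n' m' e' : ℕ} (h : HasFullRookDominating n m e)
    (h' : HasFullRookDominating n' m' e') :
    HasFullRookDominating (n + n') (m + m') (e + e') := by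
  obtain ⟨S, hS, hr, hc, he⟩ := h
  obtain ⟨S', hS', hr', hc', he'⟩ := h'
  let L := Prod.map (Fin.castAdd (n := n) n') (Fin.castAdd (n := m) m') '' S
  let R := Prod.map (Fin.natAdd (m := n') n) (Fin.natAdd (m := m') m) '' S'
  have inl_mem : ∀ {i j}, (i, j) ∈ S → (Fin.castAdd n' i, Fin.castAdd m' j) ∈ L ∪ R :=
    fun h => Or.inl ⟨_, h, rfl⟩
  have inr_mem : ∀ {i j}, (i, j) ∈ S' → (Fin.natAdd n i, Fin.natAdd m j) ∈ L ∪ R :=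
    fun h => Or.inr ⟨_, h, rfl⟩
  have lr : ∀ {k k' : ℕ} (x : Fin k) (y : Fin k'), Fin.castAdd k' x ≠ Fin.natAdd k y := by
    intro k k' x y h
    have := congrArg Fin.val h
    simp at this
    omega
  refine ⟨L ∪ R, fun i j => ?_, fun i => ?_, fun j => ?_, (Set.ncard_union_le _ _).trans
    (add_le_add ((Set.ncard_image_le (Set.toFinite _)).trans he)
      ((Set.ncard_image_le (Set.toFinite _)).trans he'))⟩
  · induction i using Fin.addCases with
    | left i =>
      induction j using Fin.addCases with
      | left j =>
        obtain ⟨⟨u, u'⟩, hu, ⟨w, w'⟩, hw, hne, hau, haw⟩ := hS i j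
        refine ⟨_, inl_mem hu, _, inl_mem hw, ?_, ?_, ?_⟩
        · simpa [Prod.ext_iff] using hne
        · simpa using hau
        · simpa using haw
      | right j =>
        obtain ⟨j₁, h₁⟩ := hr i
        obtain ⟨i₁, h₂⟩ := hc' j
        exact ⟨_, inl_mem h₁, _, inr_mem h₂, fun h => lr _ _ (Prod.ext_iff.1 h).1,
          Or.inr ⟨(lr _ _).symm, rfl⟩, Or.inl ⟨lr _ _, rfl⟩⟩
    | right i =>
      induction j using Fin.addCases with
      | left j =>
        obtain ⟨j₁, h₁⟩ := hr' i
        obtain ⟨i₁, h₂⟩ := hc j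
        exact ⟨_, inr_mem h₁, _, inl_mem h₂, fun h => lr _ _ (Prod.ext_iff.1 h).1.symm,
          Or.inr ⟨lr _ _, rfl⟩, Or.inl ⟨(lr _ _).symm, rfl⟩⟩
      | right j =>
        obtain ⟨⟨u, u'⟩, hu, ⟨w, w'⟩, hw, hne, hau, haw⟩ := hS' i j
        refine ⟨_, inr_mem hu, _, inr_mem hw, ?_, ?_, ?_⟩
        · simpa [Prod.ext_iff] using hne
        · simpa using hau
        · simpa using haw
  · induction i using Fin.addCases with
    | left i => obtain ⟨j, h⟩ := hr i; exact ⟨_, inl_mem h⟩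
    | right i => obtain ⟨j, h⟩ := hr' i; exact ⟨_, inr_mem h⟩
  · induction j using Fin.addCases with
    | left j => obtain ⟨i, h⟩ := hc j; exact ⟨_, inl_mem h⟩
    | right j => obtain ⟨i, h⟩ := hc' j; exact ⟨_, inr_mem h⟩

lemma Fin.exists_two_ne {k : ℕ} (hk : 3 ≤ k) (j : Fin k) :
    ∃ a b : Fin k, (a : ℕ) < 3 ∧ (b : ℕ) < 3 ∧ a ≠ b ∧ j ≠ a ∧ j ≠ b := by
  by_cases h0 : (j : ℕ) = 0
  · exact ⟨⟨1, by omega⟩, ⟨2, by omega⟩, by simp, by simp, by simp,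
      fun h => by simp [h] at h0, fun h => by simp [h] at h0⟩
  by_cases h1 : (j : ℕ) = 1
  · exact ⟨⟨0, by omega⟩, ⟨2, by omega⟩, by simp, by simp, by simp,
      fun h => by simp [h] at h1, fun h => by simp [h] at h1⟩
  · exact ⟨⟨0, by omega⟩, ⟨1, by omega⟩, by simp, by simp, by simp,
      fun h => by simp [h] at h0, fun h => by simp [h] at h1⟩

lemma hasRookDominating_one {m : ℕ} (hm : 3 ≤ m) : HasRookDominating 1 m 3 := by
  refine ⟨Set.range fun x : Fin 3 => ((0 : Fin 1), Fin.castLE hm x), fun i j => ?_, ?_⟩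
  · obtain ⟨a, b, ha, hb, hab, hja, hjb⟩ := Fin.exists_two_ne hm j
    exact ⟨_, ⟨⟨a, ha⟩, rfl⟩, _, ⟨⟨b, hb⟩, rfl⟩, fun h => hab (Prod.ext_iff.1 h).2,
      Or.inr ⟨hja, Subsingleton.elim _ _⟩, Or.inr ⟨hjb, Subsingleton.elim _ _⟩⟩
  · rw [← Set.image_univ]
    exact (Set.ncard_image_le (Set.toFinite _)).trans (by simp [Set.ncard_univ])

lemma hasFullRookDominating_one {m : ℕ} (hm : 3 ≤ m) : HasFullRookDominating 1 m m := by
  refine ⟨Set.univ, fun i j => ?_, fun _ => ⟨⟨0, by omega⟩, trivial⟩, fun _ => ⟨0, trivial⟩,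
    by simp [Set.ncard_univ]⟩
  obtain ⟨a, b, -, -, hab, hja, hjb⟩ := Fin.exists_two_ne hm j
  exact ⟨(i, a), trivial, (i, b), trivial, fun h => hab (Prod.ext_iff.1 h).2,
    Or.inr ⟨hja, rfl⟩, Or.inr ⟨hjb, rfl⟩⟩

/-- A cycle through the first `n` columns dominates the board. -/
lemma hasRookDominating_two_mul {n m : ℕ} (hn : 2 ≤ n) (hnm : n ≤ m) :
    HasRookDominating n m (2 * n) := by
  obtain ⟨k, rfl⟩ := Nat.exists_eq_add_of_le' hn
  set f : Fin (k + 2) → Fin m := Fin.castLE hnm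
  have hf : Function.Injective f := Fin.castLE_injective hnm
  have hne : ∀ i : Fin (k + 2), i + 1 ≠ i := fun i => by simp
  have hne' : ∀ i : Fin (k + 2), i ≠ i - 1 := fun i h => hne (i - 1) (by simpa using h)
  refine ⟨(Set.range fun i => (i, f i)) ∪ Set.range fun i => (i, f (i + 1)), fun i j => ?_, ?_⟩
  · by_cases h₁ : j = f i
    · subst h₁
      refine ⟨_, Or.inr ⟨i, rfl⟩, _, Or.inr ⟨i - 1, rfl⟩, fun h => hne' i (Prod.ext_iff.1 h).1,
        Or.inr ⟨fun h => hne i (hf h).symm, rfl⟩, Or.inl ⟨hne' i, ?_⟩⟩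
      simp
    by_cases h₂ : j = f (i + 1)
    · subst h₂
      exact ⟨_, Or.inl ⟨i, rfl⟩, _, Or.inl ⟨i + 1, rfl⟩, fun h => hne i (Prod.ext_iff.1 h).1.symm,
        Or.inr ⟨h₁, rfl⟩, Or.inl ⟨(hne i).symm, rfl⟩⟩
    · exact ⟨_, Or.inl ⟨i, rfl⟩, _, Or.inr ⟨i, rfl⟩,
        fun h => hne i (hf (Prod.ext_iff.1 h).2).symm, Or.inr ⟨h₁, rfl⟩, Or.inr ⟨h₂, rfl⟩⟩
  · refine (Set.ncard_union_le _ _).trans ?_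
    rw [two_mul, ← Set.image_univ, ← Set.image_univ]
    exact add_le_add ((Set.ncard_image_le (Set.toFinite _)).trans (by simp [Set.ncard_univ]))
      ((Set.ncard_image_le (Set.toFinite _)).trans (by simp [Set.ncard_univ]))

lemma hasFullRookDominating_two_two : HasFullRookDominating 2 2 4 := by
  refine ⟨Set.univ, fun i j => ⟨(i + 1, j), trivial, (i, j + 1), trivial, ?_, ?_, ?_⟩,
    fun _ => ⟨0, trivial⟩, fun _ => ⟨0, trivial⟩, by simp [Set.ncard_univ]⟩ <;> simp

lemma hasFullRookDominating_stars {a q : ℕ} (h : q = 0 ∨ 1 ≤ a) :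
    HasFullRookDominating a (3 * a + q) (3 * a + q) := by
  induction a generalizing q with
  | zero =>
    obtain rfl : q = 0 := by omega
    exact ⟨∅, fun i => i.elim0, fun i => i.elim0, fun j => j.elim0, by simp⟩
  | succ a ih =>
    have := (ih (q := 0) (Or.inl rfl)).add (hasFullRookDominating_one (m := 3 + q) (by omega))
    convert this using 1 <;> ring

/-- `a` horizontal and `b` vertical stars, `p` rows and `q` columns of which are extra leaves. -/
lemma hasFullRookDominating_blocks {n m e : ℕ} (a b p q : ℕ) (hp : p = 0 ∨ 1 ≤ b)
    (hq : q = 0 ∨ 1 ≤ a) (hn : n = a + 3 * b + p) (hm : m = 3 * a + b + q) (he : n + m ≤ e + a + b) :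
    HasFullRookDominating n m e := by
  obtain ⟨S, hS, hr, hc, hcard⟩ :=
    (hasFullRookDominating_stars hq).add (hasFullRookDominating_stars hp).swap
  obtain rfl : n = a + (3 * b + p) := by omega
  obtain rfl : m = 3 * a + q + b := by omega
  exact ⟨S, hS, hr, hc, by omega⟩

lemma hasRookDominating_of_le {n m e : ℕ} (hn : 1 ≤ n) (hnm : n ≤ m) (h11 : ¬ (n = 1 ∧ m ≤ 2))
    (h33 : ¬ (n = 3 ∧ m = 3)) (h34 : ¬ (n = 3 ∧ m = 4)) (he : 3 * (n + m) ≤ 4 * e)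
    (he' : m % 8 = (3 * n + 4) % 8 → 3 * (n + m) < 4 * e) : HasRookDominating n m e := by
  rcases Nat.lt_or_ge e (2 * n) with hlt | hge
  · by_cases hbad : m % 8 = (3 * n + 4) % 8
    · obtain ⟨S, hS, -, -, hcard⟩ := (hasFullRookDominating_blocks (n := n - 2) (m := m - 2)
        (e := e - 4) ((3 * m - n - 4) / 8) ((3 * n - m - 4) / 8) 0 0 (by omega) (by omega)
        (by omega) (by omega) (by omega)).add hasFullRookDominating_two_two
      obtain ⟨n, rfl⟩ := Nat.exists_eq_add_of_le' (show 2 ≤ n by omega)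
      obtain ⟨m, rfl⟩ := Nat.exists_eq_add_of_le' (show 2 ≤ m by omega)
      exact ⟨S, hS, by omega⟩
    · refine HasFullRookDominating.hasRookDominating ?_
      have hmod : (3 * n - m) % 8 = 0 ∨ (3 * n - m) % 8 = 7 ∨ (3 * n - m) % 8 = 3 ∨
        (3 * n - m) % 8 = 2 ∨ (3 * n - m) % 8 = 6 ∨ (3 * n - m) % 8 = 5 ∨
        (3 * n - m) % 8 = 1 := by omega
      rcases hmod with h | h | h | h | h | h | h
      · exact hasFullRookDominating_blocks ((3 * m - n) / 8) ((3 * n - m) / 8) 0 0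
          (by omega) (by omega) (by omega) (by omega) (by omega)
      · exact hasFullRookDominating_blocks ((3 * m - n - 3) / 8) ((3 * n - m + 1) / 8) 0 1
          (by omega) (by omega) (by omega) (by omega) (by omega)
      · exact hasFullRookDominating_blocks ((3 * m - n + 1) / 8) ((3 * n - m - 3) / 8) 1 0
          (by omega) (by omega) (by omega) (by omega) (by omega)
      · exact hasFullRookDominating_blocks ((3 * m - n - 2) / 8) ((3 * n - m - 2) / 8) 1 1
          (by omega) (by omega) (by omega) (by omega) (by omega)
      · exact hasFullRookDominating_blocks ((3 * m - n - 6) / 8) ((3 * n - m + 2) / 8) 0 2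
          (by omega) (by omega) (by omega) (by omega) (by omega)
      · exact hasFullRookDominating_blocks ((3 * m - n - 9) / 8) ((3 * n - m + 3) / 8) 0 3
          (by omega) (by omega) (by omega) (by omega) (by omega)
      · exact hasFullRookDominating_blocks ((3 * m - n - 5) / 8) ((3 * n - m - 1) / 8) 1 2
          (by omega) (by omega) (by omega) (by omega) (by omega)
  · rcases Nat.lt_or_ge 1 n with hn2 | hn1
    · obtain ⟨S, hS, hcard⟩ := hasRookDominating_two_mul hn2 hnm
      exact ⟨S, hS, hcard.trans hge⟩
    · obtain rfl : n = 1 := by omega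
      obtain ⟨S, hS, hcard⟩ := hasRookDominating_one (m := m) (by omega)
      exact ⟨S, hS, by omega⟩

lemma ceil_three_mul_add_div_four (n m : ℕ) :
    ⌈(3 * ((n : ℚ) + m)) / 4⌉₊ = (3 * (n + m) + 3) / 4 := by
  have key : ∀ k : ℕ, ⌈(3 * ((n : ℚ) + m)) / 4⌉₊ ≤ k ↔ 3 * (n + m) ≤ k * 4 := fun k => by
    rw [Nat.ceil_le, div_le_iff₀ (by norm_num)]
    exact_mod_cast Iff.rfl
  apply le_antisymm
  · rw [key]; omega
  · have := (key _).1 le_rfl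
    omega

theorem two_tuple_total_domination_rook_no_zero_row_col (n m : ℕ) (hn : 1 ≤ n) (hm : 1 ≤ m)
    (hexc : (n, m) ∉ ({(1, 1), (1, 2), (2, 1), (2, 2), (3, 3), (3, 4), (4, 3)} : Set (ℕ × ℕ)))
    (D : Set (Fin n × Fin m))
    (hD : IsKTDS ((⊤ : SimpleGraph (Fin n)) □ (⊤ : SimpleGraph (Fin m))) 2 D)
    (hmin : D.ncard = kTotalDomNum ((⊤ : SimpleGraph (Fin n)) □ (⊤ : SimpleGraph (Fin m))) 2)
    (hrow : ∀ i : Fin n, ∃ j : Fin m, (i, j) ∈ D)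
    (hcol : ∀ j : Fin m, ∃ i : Fin n, (i, j) ∈ D) :
    kTotalDomNum ((⊤ : SimpleGraph (Fin n)) □ (⊤ : SimpleGraph (Fin m))) 2 =
      if m % 8 = (3 * n + 4) % 8 then ⌈(3 * ((n : ℚ) + m)) / 4⌉₊ + 1
      else ⌈(3 * ((n : ℚ) + m)) / 4⌉₊ := by
  rw [ceil_three_mul_add_div_four]
  simp only [Set.mem_insert_iff, Set.mem_singleton_iff, Prod.mk.injEq, not_or] at hexc
  obtain ⟨F, rfl⟩ := (Set.toFinite D).exists_finset_coe
  obtain ⟨hlow, hlow'⟩ := three_mul_le_four_mul_card hD hrow hcol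
  rw [Set.ncard_coe_finset] at hmin
  rw [hmin] at hlow hlow'
  have hupp : ∀ e, 3 * (n + m) ≤ 4 * e → (m % 8 = (3 * n + 4) % 8 → 3 * (n + m) < 4 * e) →
      kTotalDomNum ((⊤ : SimpleGraph (Fin n)) □ (⊤ : SimpleGraph (Fin m))) 2 ≤ e := by
    intro e he he'
    apply HasRookDominating.kTotalDomNum_le
    rcases le_total n m with h | h
    · exact hasRookDominating_of_le hn h (by omega) (by omega) (by omega) he he'
    · exact (hasRookDominating_of_le hm h (by omega) (by omega) (by omega) (by omega)
        (by omega)).swap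
  apply le_antisymm
  · apply hupp <;> split_ifs <;> omega
  · split_ifs <;> omega
end
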